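/- Let A be a regular Hopf coquasigroup over a field k with a faithful left integral φ, and set ψ = φ∘S. Then there exists a unique invertible element δ ∈ A such that φ(a₍₁₎)a₍₂₎ = φ(a)δ for all a ∈ A; moreover this δ satisfies a₍₁₎ψ(a₍₂₎) = ψ(a)δ⁻¹ for all a ∈ A, φ(S(a)) = φ(aδ) for all a ∈ A, ε(δ) = 1, and S(δ) = δ⁻¹. -/

import Mathlib

open TensorProduct

/-- A regular Hopf coquasigroup over a field `k`: a unital associative `k`-algebra `A`
with a (not necessarily coassociative) coproduct `comul : A →ₐ[k] A ⊗[k] A`, a counit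
`counit : A →ₐ[k] k`, and a bijective antipode `antipode : A ≃ₗ[k] A` which is
antimultiplicative, anticomultiplicative, and satisfies the quasigroup antipode
identities. -/
structure RegularHopfCoquasigroup (k A : Type*) [Field k] [Ring A] [Algebra k A] where
  comul : A →ₐ[k] A ⊗[k] A
  counit : A →ₐ[k] k
  antipode : A ≃ₗ[k] A
  /-- `(ε ⊗ id) ∘ Δ = id` -/
  counit_comul_left : ∀ a : A,
    (TensorProduct.lid k A) ((LinearMap.rTensor A counit.toLinearMap) (comul a)) = a
  /-- `(id ⊗ ε) ∘ Δ = id` -/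
  counit_comul_right : ∀ a : A,
    (TensorProduct.rid k A) ((LinearMap.lTensor A counit.toLinearMap) (comul a)) = a
  /-- `S(ab) = S(b)S(a)` -/
  antipode_mul : ∀ a b : A, antipode (a * b) = antipode b * antipode a
  /-- `S(1) = 1` -/
  antipode_one : antipode (1 : A) = 1
  /-- `Δ ∘ S = (S ⊗ S) ∘ flip ∘ Δ` -/
  antipode_comul : ∀ a : A,
    comul (antipode a) =
      (TensorProduct.map antipode.toLinearMap antipode.toLinearMap)
        ((TensorProduct.comm k A A) (comul a))
  /-- `S(a₍₁₎)a₍₂₎₍₁₎ ⊗ a₍₂₎₍₂₎ = 1 ⊗ a` -/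
  quasi₁ : ∀ a : A,
    (LinearMap.rTensor A (LinearMap.mul' k A))
      ((TensorProduct.assoc k A A A).symm
        ((LinearMap.rTensor (A ⊗[k] A) antipode.toLinearMap)
          ((LinearMap.lTensor A comul.toLinearMap) (comul a)))) = (1 : A) ⊗ₜ[k] a
  /-- `a₍₁₎S(a₍₂₎₍₁₎) ⊗ a₍₂₎₍₂₎ = 1 ⊗ a` -/
  quasi₂ : ∀ a : A,
    (LinearMap.rTensor A (LinearMap.mul' k A))
      ((TensorProduct.assoc k A A A).symm
        ((LinearMap.lTensor A (LinearMap.rTensor A antipode.toLinearMap))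
          ((LinearMap.lTensor A comul.toLinearMap) (comul a)))) = (1 : A) ⊗ₜ[k] a
  /-- `a₍₁₎₍₁₎ ⊗ S(a₍₁₎₍₂₎)a₍₂₎ = a ⊗ 1` -/
  quasi₃ : ∀ a : A,
    (LinearMap.lTensor A (LinearMap.mul' k A))
      ((TensorProduct.assoc k A A A)
        ((LinearMap.rTensor A (LinearMap.lTensor A antipode.toLinearMap))
          ((LinearMap.rTensor A comul.toLinearMap) (comul a)))) = a ⊗ₜ[k] (1 : A)
  /-- `a₍₁₎₍₁₎ ⊗ a₍₁₎₍₂₎S(a₍₂₎) = a ⊗ 1` -/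
  quasi₄ : ∀ a : A,
    (LinearMap.lTensor A (LinearMap.mul' k A))
      ((TensorProduct.assoc k A A A)
        ((LinearMap.lTensor (A ⊗[k] A) antipode.toLinearMap)
          ((LinearMap.rTensor A comul.toLinearMap) (comul a)))) = a ⊗ₜ[k] (1 : A)

variable {k A : Type*} [Field k] [Ring A] [Algebra k A]

/-- `(id ⊗ f)` on `A ⊗[k] A`, composed with `A ⊗ k ≅ A`; so `idT f (a ⊗ b) = f b • a`,
i.e. in Sweedler notation `idT f (Δ a) = a₍₁₎ f(a₍₂₎)`. -/
noncomputable def idT (f : A →ₗ[k] k) : A ⊗[k] A →ₗ[k] A :=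
  (TensorProduct.rid k A).toLinearMap ∘ₗ LinearMap.lTensor A f

/-- `(f ⊗ id)` on `A ⊗[k] A`, composed with `k ⊗ A ≅ A`; so `Tid f (a ⊗ b) = f a • b`,
i.e. in Sweedler notation `Tid f (Δ a) = f(a₍₁₎) a₍₂₎`. -/
noncomputable def Tid (f : A →ₗ[k] k) : A ⊗[k] A →ₗ[k] A :=
  (TensorProduct.lid k A).toLinearMap ∘ₗ LinearMap.rTensor A f

/-- A linear functional `f` on `A` is faithful if `f(a·) = 0` implies `a = 0` and
`f(·a) = 0` implies `a = 0`. -/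
def Faithful (f : A →ₗ[k] k) : Prop :=
  (∀ a : A, (∀ b : A, f (a * b) = 0) → a = 0) ∧
  (∀ a : A, (∀ b : A, f (b * a) = 0) → a = 0)

/-- A left integral: a nonzero functional `φ` with `a₍₁₎ φ(a₍₂₎) = φ(a)·1`. -/
def IsLeftIntegral (H : RegularHopfCoquasigroup k A) (φ : A →ₗ[k] k) : Prop :=
  φ ≠ 0 ∧ ∀ a : A, idT φ (H.comul a) = φ a • (1 : A)

/-- A right integral: a nonzero functional `ψ` with `ψ(a₍₁₎) a₍₂₎ = ψ(a)·1`. -/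
def IsRightIntegral (H : RegularHopfCoquasigroup k A) (ψ : A →ₗ[k] k) : Prop :=
  ψ ≠ 0 ∧ ∀ a : A, Tid ψ (H.comul a) = ψ a • (1 : A)

@[simp]
theorem idT_tmul (f : A →ₗ[k] k) (x y : A) : idT f (x ⊗ₜ[k] y) = f y • x := by
  simp [idT]

@[simp]
theorem Tid_tmul (f : A →ₗ[k] k) (x y : A) : Tid f (x ⊗ₜ[k] y) = f x • y := by
  simp [Tid]

theorem idT_tmul_one_mul (f : A →ₗ[k] k) (x : A) (t : A ⊗[k] A) :
    idT f ((x ⊗ₜ[k] (1 : A)) * t) = x * idT f t := by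
  induction t with
  | zero => simp
  | tmul u v => simp
  | add t u ht hu => simp only [mul_add, map_add, ht, hu]

theorem apply_idT (f g : A →ₗ[k] k) (t : A ⊗[k] A) : g (idT f t) = f (Tid g t) := by
  induction t with
  | zero => simp
  | tmul u v => simp [mul_comm]
  | add t u ht hu => simp only [map_add, ht, hu]

theorem Tid_one_tmul_mul (f : A →ₗ[k] k) (a : A) (t : A ⊗[k] A) :
    Tid f (((1 : A) ⊗ₜ[k] a) * t) = a * Tid f t := by
  induction t with
  | zero => simp
  | tmul u v => simp
  | add t u ht hu => simp only [mul_add, map_add, ht, hu]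

theorem Tid_mul_one_tmul (f : A →ₗ[k] k) (a : A) (t : A ⊗[k] A) :
    Tid f (t * ((1 : A) ⊗ₜ[k] a)) = Tid f t * a := by
  induction t with
  | zero => simp
  | tmul u v => simp
  | add t u ht hu => simp only [add_mul, map_add, ht, hu]

namespace RegularHopfCoquasigroup

variable (H : RegularHopfCoquasigroup k A)

/-- `c₍₁₎ φ(a c₍₂₎) = S(a₍₁₎) φ(a₍₂₎ c)` for a left integral `φ`. -/
theorem idT_one_tmul_mul_comul {φ : A →ₗ[k] k} (hφ : IsLeftIntegral H φ) (a c : A) :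
    idT φ (((1 : A) ⊗ₜ[k] a) * H.comul c) =
      H.antipode (idT φ (H.comul a * ((1 : A) ⊗ₜ[k] c))) := by
  have expand_comul (x : A) (u : A ⊗[k] A) :
      LinearMap.rTensor A (LinearMap.mul' k A) ((TensorProduct.assoc k A A A).symm
        (x ⊗ₜ[k] u)) = (x ⊗ₜ[k] (1 : A)) * u := by
    induction u with
    | zero => simp
    | tmul v w => simp
    | add u v hu hv => simp only [TensorProduct.tmul_add, mul_add, map_add, hu, hv]
  rw [← H.quasi₁ a]
  generalize H.comul a = t
  induction t with
  | zero => simp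
  | tmul x y =>
    simp only [LinearMap.lTensor_tmul, LinearMap.rTensor_tmul, expand_comul,
      AlgHom.toLinearMap_apply, LinearEquiv.coe_coe, mul_assoc, ← map_mul,
      idT_tmul_one_mul, hφ.2]
    simp
  | add t u ht hu => simp only [map_add, add_mul, ht, hu]

theorem Tid_comul_antipode (f : A →ₗ[k] k) (a : A) :
    Tid f (H.comul (H.antipode a)) =
      H.antipode (idT (f ∘ₗ H.antipode.toLinearMap) (H.comul a)) := by
  rw [H.antipode_comul]
  induction H.comul a with
  | zero => simp
  | tmul x y => simp
  | add t u ht hu => simp only [map_add, ht, hu]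

theorem idT_comul_antipode (f : A →ₗ[k] k) (a : A) :
    idT f (H.comul (H.antipode a)) =
      H.antipode (Tid (f ∘ₗ H.antipode.toLinearMap) (H.comul a)) := by
  rw [H.antipode_comul]
  induction H.comul a with
  | zero => simp
  | tmul x y => simp
  | add t u ht hu => simp only [map_add, ht, hu]

/-- `φ ∘ S` is right invariant when `φ` is a left integral. -/
theorem Tid_comp_antipode {φ : A →ₗ[k] k} (hφ : IsLeftIntegral H φ) (a : A) :
    Tid (φ ∘ₗ H.antipode.toLinearMap) (H.comul a) = φ (H.antipode a) • (1 : A) := by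
  apply H.antipode.injective
  rw [← H.idT_comul_antipode, hφ.2, map_smul, H.antipode_one]

/-- `φ(a (φ ⊗ id)Δ(c)) = φ(S(a)) φ(c)` for a left integral `φ`. -/
theorem apply_mul_Tid_comul {φ : A →ₗ[k] k} (hφ : IsLeftIntegral H φ) (a c : A) :
    φ (a * Tid φ (H.comul c)) = φ (H.antipode a) * φ c := by
  have h := congrArg φ (H.idT_one_tmul_mul_comul hφ a c)
  rw [apply_idT, Tid_one_tmul_mul] at h
  rw [h, ← LinearEquiv.coe_coe, ← LinearMap.comp_apply, apply_idT, Tid_mul_one_tmul,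
    H.Tid_comp_antipode hφ]
  simp

/-- `ψ(b (id ⊗ ψ)Δ(d)) = φ(b) ψ(d)` for a left integral `φ` and `ψ = φ ∘ S`. -/
theorem apply_antipode_mul_idT_comul {φ : A →ₗ[k] k} (hφ : IsLeftIntegral H φ) (b d : A) :
    φ (H.antipode (b * idT (φ ∘ₗ H.antipode.toLinearMap) (H.comul d))) =
      φ b * φ (H.antipode d) := by
  have h := congrArg (φ ∘ₗ H.antipode.symm.toLinearMap)
    (H.idT_one_tmul_mul_comul hφ (H.antipode d) (H.antipode b))
  rw [H.antipode_comul, H.antipode_comul] at h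
  have left (t : A ⊗[k] A) : (φ ∘ₗ H.antipode.symm.toLinearMap)
      (idT φ (((1 : A) ⊗ₜ[k] H.antipode d) *
        TensorProduct.map H.antipode.toLinearMap H.antipode.toLinearMap
          (TensorProduct.comm k A A t))) = φ (H.antipode (idT φ t * d)) := by
    induction t with
    | zero => simp
    | tmul x y => simp [H.antipode_mul, mul_comm]
    | add t u ht hu => simp only [map_add, mul_add, add_mul, ht, hu]
  have right (t : A ⊗[k] A) : (φ ∘ₗ H.antipode.symm.toLinearMap)
      (H.antipode (idT φ (TensorProduct.map H.antipode.toLinearMap H.antipode.toLinearMap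
          (TensorProduct.comm k A A t) * ((1 : A) ⊗ₜ[k] H.antipode b)))) =
      φ (H.antipode (b * idT (φ ∘ₗ H.antipode.toLinearMap) t)) := by
    induction t with
    | zero => simp
    | tmul x y => simp [H.antipode_mul, mul_comm]
    | add t u ht hu => simp only [map_add, mul_add, add_mul, ht, hu]
  rw [left, right, hφ.2] at h
  simpa using h.symm

end RegularHopfCoquasigroup

/-- existence and uniqueness of the modular element `δ`:
an invertible `δ` with `φ(a₍₁₎)a₍₂₎ = φ(a)δ`, unique among invertible elements with this
property, and with `a₍₁₎ψ(a₍₂₎) = ψ(a)δ⁻¹` for `ψ = φ∘S`, `φ(S(a)) = φ(aδ)`, `ε(δ) = 1`,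
`S(δ) = δ⁻¹`. -/
theorem stmt_9 (k A : Type*) [Field k] [Ring A] [Algebra k A]
    (H : RegularHopfCoquasigroup k A) (φ : A →ₗ[k] k)
    (hφ : IsLeftIntegral H φ) (hf : Faithful φ) :
    ∃ δ δi : A,
      δ * δi = 1 ∧ δi * δ = 1 ∧
      (∀ a : A, Tid φ (H.comul a) = φ a • δ) ∧
      (∀ δ' : A, IsUnit δ' → (∀ a : A, Tid φ (H.comul a) = φ a • δ') → δ' = δ) ∧
      (∀ a : A, idT (φ ∘ₗ H.antipode.toLinearMap) (H.comul a) =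
        φ (H.antipode a) • δi) ∧
      (∀ a : A, φ (H.antipode a) = φ (a * δ)) ∧
      H.counit δ = 1 ∧
      H.antipode δ = δi := by
  obtain ⟨c₀, hc₀⟩ : ∃ c, φ c ≠ 0 := by
    by_contra! h
    exact hφ.1 (LinearMap.ext h)
  have cancel_left {x y : A} (h : ∀ b, φ (b * x) = φ (b * y)) : x = y := by
    refine sub_eq_zero.1 (hf.2 _ fun b => ?_)
    rw [mul_sub, map_sub, h, sub_self]
  set δ : A := (φ c₀)⁻¹ • Tid φ (H.comul c₀) with hδ
  have φ_antipode (a : A) : φ (H.antipode a) = φ (a * δ) := by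
    rw [hδ, mul_smul_comm, map_smul, H.apply_mul_Tid_comul hφ, smul_eq_mul]
    field_simp
  have Tid_eq (a : A) : Tid φ (H.comul a) = φ a • δ := by
    refine cancel_left fun b => ?_
    rw [H.apply_mul_Tid_comul hφ, mul_smul_comm, map_smul, ← φ_antipode, smul_eq_mul, mul_comm]
  have idT_eq (a : A) : idT (φ ∘ₗ H.antipode.toLinearMap) (H.comul a) =
      φ (H.antipode a) • H.antipode.symm δ := by
    apply H.antipode.injective
    rw [← H.Tid_comul_antipode, Tid_eq, map_smul, LinearEquiv.apply_symm_apply]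
  have antipode_φ (b : A) : φ (H.antipode (b * H.antipode.symm δ)) = φ b := by
    have h := H.apply_antipode_mul_idT_comul hφ b (H.antipode.symm c₀)
    rw [idT_eq, mul_smul_comm, map_smul, map_smul, LinearEquiv.apply_symm_apply, smul_eq_mul,
      mul_comm (φ b)] at h
    exact mul_left_cancel₀ hc₀ h
  have symm_mul : H.antipode.symm δ * δ = 1 := cancel_left fun b => by
    rw [← mul_assoc, ← φ_antipode, antipode_φ, mul_one]
  have mul_antipode : H.antipode δ * δ = 1 := by
    have h := congrArg H.antipode symm_mul
    rwa [H.antipode_mul, LinearEquiv.apply_symm_apply, H.antipode_one] at h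
  have mul_symm : δ * H.antipode.symm δ = 1 := by
    have h : H.antipode (δ * H.antipode.symm δ) = 1 := by
      refine sub_eq_zero.1 (hf.1 _ fun b => ?_)
      obtain ⟨b, rfl⟩ := H.antipode.surjective b
      rw [sub_mul, one_mul, map_sub, ← H.antipode_mul, ← mul_assoc, antipode_φ, φ_antipode,
        sub_self]
    exact H.antipode.injective (h.trans H.antipode_one.symm)
  refine ⟨δ, H.antipode.symm δ, mul_symm, symm_mul, Tid_eq, fun δ' _ h => ?_, idT_eq,
    φ_antipode, ?_, left_inv_eq_right_inv mul_antipode mul_symm⟩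
  · exact smul_right_injective A hc₀ ((h c₀).symm.trans (Tid_eq c₀))
  · have h := congrArg H.counit (Tid_eq c₀)
    rw [← AlgHom.toLinearMap_apply, ← apply_idT] at h
    have hε : idT H.counit.toLinearMap (H.comul c₀) = c₀ := H.counit_comul_right c₀
    rw [hε, map_smul, smul_eq_mul] at h
    exact mul_left_cancel₀ hc₀ (h.symm.trans (mul_one _).symm)
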